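/- Fix a real ℓ ≥ 1 and let κ_ℓ := (∫_{1/2}^1 (x(1−x)³)^{ℓ/(ℓ+4)} dx)^{−1}. Define g_{ℓ,Opt} : (0,1) → ℝ by g_{ℓ,Opt}(x) := κ_ℓ·∫_{1/2}^x (t^{ℓ−8}(1−t)^{2ℓ+4})^{1/(ℓ+4)} dt for x ≤ 1/2, and g_{ℓ,Opt}(x) := κ_ℓ·∫_{1/2}^x (t^ℓ (1−t)^{2ℓ−4})^{1/(ℓ+4)} dt for x ≥ 1/2. Then g_{ℓ,Opt} is a continuously differentiable normalized proper scoring rule, and for every continuously differentiable normalized proper scoring rule g that is not identically equal to g_{ℓ,Opt} on (0,1), one has Ind^ℓ(g_{ℓ,Opt}) < Ind^ℓ(g). -/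

import Mathlib

open MeasureTheory Set

noncomputable def rewardFn (f : ℝ → ℝ) : ℝ → ℝ := fun x => x * f x + (1 - x) * f (1 - x)

/-- `f` is a (strictly) proper scoring rule: for every belief `p ∈ (0,1)`,
the expected reward `x ↦ p·f(x) + (1−p)·f(1−x)` is strictly maximized over `(0,1)` at `x = p`. -/
def IsProperRule (f : ℝ → ℝ) : Prop :=
  ∀ p ∈ Set.Ioo (0:ℝ) 1, ∀ x ∈ Set.Ioo (0:ℝ) 1, x ≠ p →
    p * f x + (1 - p) * f (1 - x) < p * f p + (1 - p) * f (1 - p)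

/-- `f` is a weakly proper scoring rule: for every belief `p ∈ (0,1)`,
the expected reward `x ↦ p·f(x) + (1−p)·f(1−x)` is (weakly) maximized over `(0,1)` at `x = p`. -/
def IsWeaklyProperRule (f : ℝ → ℝ) : Prop :=
  ∀ p ∈ Set.Ioo (0:ℝ) 1, ∀ x ∈ Set.Ioo (0:ℝ) 1,
    p * f x + (1 - p) * f (1 - x) ≤ p * f p + (1 - p) * f (1 - p)
open scoped ENNReal

/-- A scoring rule `g` is normalized if `g(1/2) = 0` and `∫₀¹ R^g(x) dx = 1`. -/
noncomputable def IsNormalizedRule (g : ℝ → ℝ) : Prop :=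
  g (1/2) = 0 ∧ (∫ x in (0:ℝ)..1, rewardFn g x) = 1

/-- The incentivization index `Ind^ℓ(g) = ∫₀¹ (x(1−x)/(R^g)″(x))^{ℓ/4} dx`, valued in `[0,∞]`,
using `(R^g)″(x) = g′(x) + g′(1−x)` for continuously differentiable proper scoring rules. -/
noncomputable def Ind (ℓ : ℝ) (g : ℝ → ℝ) : ℝ≥0∞ :=
  ∫⁻ x in Set.Ioo (0:ℝ) 1,
    (ENNReal.ofReal (x * (1 - x)) / ENNReal.ofReal (deriv g x + deriv g (1 - x))) ^ (ℓ / 4)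

/-- The normalization constant `κ_ℓ`. -/
noncomputable def kappa (ℓ : ℝ) : ℝ :=
  (∫ x in Set.Ico (1/2 : ℝ) 1, (x * (1 - x) ^ (3:ℕ)) ^ (ℓ / (ℓ + 4)))⁻¹

/-- The optimal scoring rule `g_{ℓ,Opt}`. -/
noncomputable def gOpt (ℓ : ℝ) : ℝ → ℝ := fun x =>
  if x ≤ 1/2 then
    kappa ℓ * ∫ t in (1/2:ℝ)..x, (t ^ (ℓ - 8) * (1 - t) ^ (2 * ℓ + 4)) ^ (1 / (ℓ + 4))
  else
    kappa ℓ * ∫ t in (1/2:ℝ)..x, (t ^ ℓ * (1 - t) ^ (2 * ℓ - 4)) ^ (1 / (ℓ + 4))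

theorem setLIntegral_Ioo_ofReal_deriv {f F : ℝ → ℝ} {a b : ℝ} (hab : a ≤ b)
    (hF : ∀ t ∈ Icc a b, HasDerivAt F (f t) t) (hc : ContinuousOn f (Icc a b))
    (hf : ∀ t ∈ Icc a b, 0 ≤ f t) :
    ∫⁻ t in Ioo a b, ENNReal.ofReal (f t) = ENNReal.ofReal (F b - F a) := by
  have hint : IntervalIntegrable f volume a b := hc.intervalIntegrable_of_Icc hab
  rw [← intervalIntegral.integral_eq_sub_of_hasDerivAt (by rwa [uIcc_of_le hab]) hint,
    intervalIntegral.integral_of_le hab, integral_Ioc_eq_integral_Ioo,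
    ofReal_integral_eq_lintegral_ofReal]
  · exact (hc.integrableOn_Icc).mono_set Ioo_subset_Icc_self
  · exact (ae_restrict_iff' measurableSet_Ioo).2 (.of_forall fun t ht => hf t (Ioo_subset_Icc_self ht))

theorem setLIntegral_eq_of_subset_of_eq_zero {f : ℝ → ℝ≥0∞} {s t : Set ℝ} (hs : MeasurableSet s)
    (ht : MeasurableSet t) (hst : s ⊆ t) (hf : ∀ x ∈ t, x ∉ s → f x = 0) :
    ∫⁻ x in t, f x = ∫⁻ x in s, f x := by
  rw [← lintegral_indicator hs, ← lintegral_indicator ht]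
  congr 1
  ext x
  by_cases hxs : x ∈ s
  · simp [hxs, hst hxs]
  · by_cases hxt : x ∈ t <;> simp [hxs, hxt, hf]

theorem setLIntegral_Ioo_zero_one_of_symm {f : ℝ → ℝ≥0∞}
    (hf : ∀ x ∈ Ioo (1 / 2 : ℝ) 1, f (1 - x) = f x) :
    ∫⁻ x in Ioo (0 : ℝ) 1, f x = 2 * ∫⁻ x in Ioo (1 / 2 : ℝ) 1, f x := by
  have hU : Ioo (0 : ℝ) 1 =ᵐ[volume] (Ioo 0 (1 / 2) ∪ Ioo (1 / 2) 1 : Set ℝ) := by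
    rw [← Ioc_union_Ioo_eq_Ioo (b := (1 / 2 : ℝ)) (by norm_num) (by norm_num)]
    exact (Ioo_ae_eq_Ioc.symm).union (ae_eq_refl _)
  have hrefl : ∫⁻ x in Ioo (0 : ℝ) (1 / 2), f x = ∫⁻ x in Ioo (1 / 2 : ℝ) 1, f x := by
    have h := (Measure.measurePreserving_sub_left volume (1 : ℝ)).setLIntegral_comp_preimage_emb
      (Homeomorph.subLeft (1 : ℝ)).measurableEmbedding f (Ioo 0 (1 / 2))
    rw [← h]
    have hpre : (fun x : ℝ => 1 - x) ⁻¹' Ioo 0 (1 / 2) = Ioo (1 / 2) 1 := by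
      rw [preimage_const_sub_Ioo]; norm_num
    rw [hpre]
    exact setLIntegral_congr_fun measurableSet_Ioo hf
  rw [setLIntegral_congr hU, lintegral_union measurableSet_Ioo, hrefl, two_mul]
  rw [Set.disjoint_left]
  rintro x hx hx'
  exact absurd hx.2 (not_lt.2 hx'.1.le)

/-- The second derivative of the reward function of a proper rule. -/
noncomputable def rewardCurv (g : ℝ → ℝ) (t : ℝ) : ℝ := deriv g t + deriv g (1 - t)

theorem rewardCurv_symm (g : ℝ → ℝ) (t : ℝ) : rewardCurv g (1 - t) = rewardCurv g t := by
  simp [rewardCurv, add_comm]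

theorem measurable_rewardCurv (g : ℝ → ℝ) : Measurable (rewardCurv g) :=
  (measurable_deriv g).add ((measurable_deriv g).comp (measurable_const.sub measurable_id))

theorem one_sub_mem_Ioo {x : ℝ} (hx : x ∈ Ioo (0 : ℝ) 1) : 1 - x ∈ Ioo (0 : ℝ) 1 :=
  ⟨by linarith [hx.2], by linarith [hx.1]⟩

section Curvature

variable {g : ℝ → ℝ} (hg : ContDiffOn ℝ 1 g (Ioo 0 1))

include hg

theorem hasDerivAt_of_contDiffOn {x : ℝ} (hx : x ∈ Ioo (0 : ℝ) 1) : HasDerivAt g (deriv g x) x :=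
  ((hg.differentiableOn one_ne_zero).differentiableAt (isOpen_Ioo.mem_nhds hx)).hasDerivAt

theorem hasDerivAt_one_sub {x : ℝ} (hx : x ∈ Ioo (0 : ℝ) 1) :
    HasDerivAt (fun x => g (1 - x)) (-deriv g (1 - x)) x := by
  simpa using (hasDerivAt_of_contDiffOn hg (one_sub_mem_Ioo hx)).comp_const_sub 1 x

theorem continuousOn_rewardCurv : ContinuousOn (rewardCurv g) (Ioo 0 1) := by
  have h := hg.continuousOn_deriv_of_isOpen isOpen_Ioo le_rfl
  exact h.add (h.comp (by fun_prop) fun x hx => one_sub_mem_Ioo hx)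

theorem hasDerivAt_expectedReward (hw : ∀ t ∈ Ioo (0 : ℝ) 1, deriv g t = (1 - t) * rewardCurv g t)
    (p : ℝ) {t : ℝ} (ht : t ∈ Ioo (0 : ℝ) 1) :
    HasDerivAt (fun x => p * g x + (1 - p) * g (1 - x)) ((p - t) * rewardCurv g t) t := by
  refine (((hasDerivAt_of_contDiffOn hg ht).const_mul p).add
    ((hasDerivAt_one_sub hg ht).const_mul (1 - p))).congr_deriv ?_
  rw [hw t ht, hw _ (one_sub_mem_Ioo ht), rewardCurv_symm]
  ring

theorem IsProperRule.deriv_eq (hp : IsProperRule g) {t : ℝ} (ht : t ∈ Ioo (0 : ℝ) 1) :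
    deriv g t = (1 - t) * rewardCurv g t := by
  have hmax : IsLocalMax (fun x => t * g x + (1 - t) * g (1 - x)) t := by
    filter_upwards [isOpen_Ioo.mem_nhds ht] with x hx
    rcases eq_or_ne x t with rfl | hne
    · rfl
    · exact (hp t ht x hx hne).le
  have h := hmax.hasDerivAt_eq_zero (((hasDerivAt_of_contDiffOn hg ht).const_mul t).add
    ((hasDerivAt_one_sub hg ht).const_mul (1 - t)))
  rw [rewardCurv]
  linear_combination h

theorem IsProperRule.rewardCurv_nonneg (hp : IsProperRule g) {t : ℝ} (ht : t ∈ Ioo (0 : ℝ) 1) :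
    0 ≤ rewardCurv g t := by
  have hmono : MonotoneOn (fun x => g x - g (1 - x)) (Ioo 0 1) := by
    intro x hx y hy hxy
    rcases hxy.eq_or_lt with rfl | hlt
    · rfl
    · have h₁ := hp x hx y hy hlt.ne'
      have h₂ := hp y hy x hx hlt.ne
      dsimp only
      nlinarith
  have h := hmono.derivWithin_nonneg (x := t)
  have hd := (hasDerivAt_of_contDiffOn hg ht).fun_sub (hasDerivAt_one_sub hg ht)
  rw [derivWithin_of_isOpen isOpen_Ioo ht, hd.deriv] at h
  simpa [rewardCurv] using h

theorem isProperRule_of_rewardCurv_pos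
    (hw : ∀ t ∈ Ioo (0 : ℝ) 1, deriv g t = (1 - t) * rewardCurv g t)
    (hpos : ∀ t ∈ Ioo (0 : ℝ) 1, 0 < rewardCurv g t) : IsProperRule g := by
  intro p hp x hx hne
  have hd := fun t ht => hasDerivAt_expectedReward hg hw p (t := t) ht
  rcases hne.lt_or_gt with hlt | hlt
  · have hsub : Icc x p ⊆ Ioo 0 1 := fun t ht => ⟨hx.1.trans_le ht.1, ht.2.trans_lt hp.2⟩
    refine strictMonoOn_of_deriv_pos (convex_Icc x p)
      (fun t ht => (hd t (hsub ht)).continuousAt.continuousWithinAt) (fun t ht => ?_)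
      (left_mem_Icc.2 hlt.le) (right_mem_Icc.2 hlt.le) hlt
    rw [interior_Icc] at ht
    have ht' := hsub (Ioo_subset_Icc_self ht)
    rw [(hd t ht').deriv]
    exact mul_pos (sub_pos.2 ht.2) (hpos t ht')
  · have hsub : Icc p x ⊆ Ioo 0 1 := fun t ht => ⟨hp.1.trans_le ht.1, ht.2.trans_lt hx.2⟩
    refine strictAntiOn_of_deriv_neg (convex_Icc p x)
      (fun t ht => (hd t (hsub ht)).continuousAt.continuousWithinAt) (fun t ht => ?_)
      (left_mem_Icc.2 hlt.le) (right_mem_Icc.2 hlt.le) hlt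
    rw [interior_Icc] at ht
    have ht' := hsub (Ioo_subset_Icc_self ht)
    rw [(hd t ht').deriv]
    exact mul_neg_of_neg_of_pos (sub_neg.2 ht.1) (hpos t ht')

theorem ofReal_rewardFn_eq_lintegral (h0 : g (1 / 2) = 0) (hp : IsProperRule g) {x : ℝ} (hx : x ∈ Ioo (1 / 2 : ℝ) 1) :
    ENNReal.ofReal (rewardFn g x) =
      ∫⁻ t in Ioo (1 / 2 : ℝ) 1, ENNReal.ofReal (x - t) * ENNReal.ofReal (rewardCurv g t) := by
  have hsub : Icc (1 / 2) x ⊆ Ioo (0 : ℝ) 1 := fun t ht =>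
    ⟨by linarith [ht.1], ht.2.trans_lt hx.2⟩
  have key := setLIntegral_Ioo_ofReal_deriv hx.1.le
    (fun t ht => hasDerivAt_expectedReward hg (fun t => hp.deriv_eq hg) x (hsub ht))
    ((continuousOn_const.sub continuousOn_id).mul ((continuousOn_rewardCurv hg).mono hsub))
    (fun t ht => mul_nonneg (sub_nonneg.2 ht.2) (hp.rewardCurv_nonneg hg (hsub ht)))
  rw [setLIntegral_eq_of_subset_of_eq_zero (s := Ioo (1 / 2) x) measurableSet_Ioo measurableSet_Ioo
    (Ioo_subset_Ioo_right hx.2.le)]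
  · rw [show rewardFn g x = (x * g x + (1 - x) * g (1 - x)) -
      (x * g (1 / 2) + (1 - x) * g (1 - 1 / 2)) by
        rw [show (1 - 1 / 2 : ℝ) = 1 / 2 by norm_num, h0, rewardFn]; ring, ← key]
    refine setLIntegral_congr_fun measurableSet_Ioo fun t ht => ?_
    exact ENNReal.ofReal_mul (sub_nonneg.2 ht.2.le)
  · intro t ht ht'
    have : x ≤ t := not_lt.1 fun h => ht' ⟨ht.1, h⟩
    rw [ENNReal.ofReal_of_nonpos (sub_nonpos.2 this), zero_mul]

theorem lintegral_rewardFn (h0 : g (1 / 2) = 0) (hp : IsProperRule g) :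
    ∫⁻ x in Ioo (0 : ℝ) 1, ENNReal.ofReal (rewardFn g x) =
      ∫⁻ t in Ioo (1 / 2 : ℝ) 1, ENNReal.ofReal ((1 - t) ^ 2 * rewardCurv g t) := by
  rw [setLIntegral_Ioo_zero_one_of_symm (fun x _ => by simp [rewardFn, add_comm]),
    setLIntegral_congr_fun measurableSet_Ioo
      (fun x hx => ofReal_rewardFn_eq_lintegral hg h0 hp hx), lintegral_lintegral_swap]
  · rw [← lintegral_const_mul' _ _ (by simp)]
    refine setLIntegral_congr_fun measurableSet_Ioo fun t ht => ?_
    have hd : ∀ x ∈ Icc t 1, HasDerivAt (fun x => (x - t) ^ 2 / 2) (x - t) x := fun x _ => by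
      refine ((((hasDerivAt_id x).sub_const t).pow 2).div_const 2).congr_deriv ?_
      simp
    have hinner : ∫⁻ x in Ioo (1 / 2 : ℝ) 1, ENNReal.ofReal (x - t) =
        ENNReal.ofReal ((1 - t) ^ 2 / 2) := by
      rw [setLIntegral_eq_of_subset_of_eq_zero (s := Ioo t 1) measurableSet_Ioo measurableSet_Ioo
        (Ioo_subset_Ioo_left ht.1.le), setLIntegral_Ioo_ofReal_deriv ht.2.le hd (by fun_prop)
        (fun x hx => sub_nonneg.2 hx.1)]
      · simp
      · intro x hx hx'
        have : x ≤ t := not_lt.1 fun h => hx' ⟨h, hx.2⟩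
        exact ENNReal.ofReal_of_nonpos (sub_nonpos.2 this)
    rw [lintegral_mul_const' _ _ ENNReal.ofReal_ne_top, hinner, ← mul_assoc,
      show (2 : ℝ≥0∞) = ENNReal.ofReal 2 by simp, ← ENNReal.ofReal_mul (by norm_num),
      ← ENNReal.ofReal_mul (by positivity)]
    congr 1
    ring
  · refine Measurable.aemeasurable ?_
    have := measurable_rewardCurv g
    unfold Function.uncurry
    fun_prop

theorem integral_rewardFn_eq_one_iff (h0 : g (1 / 2) = 0) (hp : IsProperRule g) :
    ∫ x in (0 : ℝ)..1, rewardFn g x = 1 ↔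
      ∫⁻ t in Ioo (1 / 2 : ℝ) 1, ENNReal.ofReal ((1 - t) ^ 2 * rewardCurv g t) = 1 := by
  rw [← lintegral_rewardFn hg h0 hp, ← ENNReal.toReal_eq_one_iff,
    ← integral_eq_lintegral_of_nonneg_ae, intervalIntegral.integral_of_le zero_le_one,
    integral_Ioc_eq_integral_Ioo]
  · refine (ae_restrict_iff' measurableSet_Ioo).2 (.of_forall fun x hx => ?_)
    rcases eq_or_ne x (1 / 2) with rfl | hne
    · norm_num [rewardFn, h0]
    · have h := hp x hx (1 / 2) ⟨by norm_num, by norm_num⟩ hne.symm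
      rw [show (1 - 1 / 2 : ℝ) = 1 / 2 by norm_num, h0, mul_zero, mul_zero, add_zero] at h
      exact h.le
  · refine ContinuousOn.aestronglyMeasurable ?_ measurableSet_Ioo
    have hc := hg.continuousOn
    have hc' : ContinuousOn (fun x => g (1 - x)) (Ioo 0 1) :=
      hc.comp (by fun_prop) fun x hx => one_sub_mem_Ioo hx
    exact (continuousOn_id.mul hc).add ((continuousOn_const.sub continuousOn_id).mul hc')

end Curvature

section TangentLine

variable {a b w w₀ : ℝ}

theorem rpow_tangent_lt (ha : 0 < a) (hb : 0 < b) (hw₀ : 0 < w₀) (hw : 0 < w) (hne : w ≠ w₀) :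
    (b / w₀) ^ a * (1 + a) < (b / w) ^ a + a * (b / w₀) ^ a * (w / w₀) := by
  have hA : 0 < (b / w₀) ^ a := by positivity
  have hu : 0 < w / w₀ := by positivity
  have h₁ : (b / w) ^ a = (b / w₀) ^ a * (w / w₀) ^ (-a) := by
    rw [Real.rpow_neg hu.le, ← Real.inv_rpow hu.le, ← Real.mul_rpow (by positivity) (by positivity)]
    congr 1
    field_simp
  have hlog := Real.log_lt_sub_one_of_pos hu (by rwa [Ne, div_eq_one_iff_eq hw₀.ne'])
  have hexp := Real.add_one_le_exp (Real.log (w / w₀) * -a)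
  rw [← Real.rpow_def_of_pos hu] at hexp
  rw [h₁]
  nlinarith [mul_lt_mul_of_pos_left hlog ha]

theorem ofReal_div_rpow_tangent_lt (ha : 0 < a) (hb : 0 < b) (hw₀ : 0 < w₀) (hw : 0 ≤ w)
    (hne : w ≠ w₀) :
    (ENNReal.ofReal b / ENNReal.ofReal w₀) ^ a + ENNReal.ofReal (a * (b / w₀) ^ a) <
      (ENNReal.ofReal b / ENNReal.ofReal w) ^ a +
        ENNReal.ofReal (a * (b / w₀) ^ a * (w / w₀)) := by
  rw [← ENNReal.ofReal_div_of_pos hw₀, ENNReal.ofReal_rpow_of_pos (by positivity),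
    ← ENNReal.ofReal_add (by positivity) (by positivity)]
  rcases hw.eq_or_lt with rfl | hw
  · rw [ENNReal.ofReal_zero, ENNReal.div_zero (by simpa using hb), ENNReal.top_rpow_of_pos ha,
      top_add]
    exact ENNReal.ofReal_lt_top
  · rw [← ENNReal.ofReal_div_of_pos hw, ENNReal.ofReal_rpow_of_pos (by positivity),
      ← ENNReal.ofReal_add (by positivity) (by positivity)]
    refine (ENNReal.ofReal_lt_ofReal_iff (by positivity)).2 ?_
    linarith [rpow_tangent_lt ha hb hw₀ hw hne]

end TangentLine

theorem lintegral_rpow_lt_of_weighted_lintegral_eq_one {α : Type*} [MeasurableSpace α]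
    {μ : Measure α} {a c : ℝ} {b m w w₀ : α → ℝ} (ha : 0 < a) (hc : 0 < c)
    (hbm : Measurable b) (hmm : Measurable m) (hwm : Measurable w) (hwm₀ : Measurable w₀)
    (hb : ∀ᵐ x ∂μ, 0 < b x) (hw : ∀ᵐ x ∂μ, 0 ≤ w x)
    (hw₀ : ∀ᵐ x ∂μ, 0 < w₀ x) (hA : ∀ᵐ x ∂μ, (b x / w₀ x) ^ a = c * (m x * w₀ x))
    (h₀ : ∫⁻ x, ENNReal.ofReal (m x * w₀ x) ∂μ = 1) (h : ∫⁻ x, ENNReal.ofReal (m x * w x) ∂μ = 1)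
    (hne : ∃ᵐ x ∂μ, w x ≠ w₀ x) :
    ∫⁻ x, (ENNReal.ofReal (b x) / ENNReal.ofReal (w₀ x)) ^ a ∂μ <
      ∫⁻ x, (ENNReal.ofReal (b x) / ENNReal.ofReal (w x)) ^ a ∂μ := by
  have hlt : ∀ᵐ x ∂μ, w x ≠ w₀ x →
      (ENNReal.ofReal (b x) / ENNReal.ofReal (w₀ x)) ^ a +
          ENNReal.ofReal (a * c) * ENNReal.ofReal (m x * w₀ x) <
        (ENNReal.ofReal (b x) / ENNReal.ofReal (w x)) ^ a +
          ENNReal.ofReal (a * c) * ENNReal.ofReal (m x * w x) := by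
    filter_upwards [hb, hw, hw₀, hA] with x hb hw hw₀ hA hne
    have key := ofReal_div_rpow_tangent_lt ha hb hw₀ hw hne
    rw [hA] at key
    rw [← ENNReal.ofReal_mul (by positivity), ← ENNReal.ofReal_mul (by positivity)]
    convert key using 3
    · ring
    · field_simp
  have hfin : ∫⁻ x, (ENNReal.ofReal (b x) / ENNReal.ofReal (w₀ x)) ^ a ∂μ = ENNReal.ofReal c := by
    rw [← mul_one (ENNReal.ofReal c), ← h₀, ← lintegral_const_mul' _ _ ENNReal.ofReal_ne_top]
    refine lintegral_congr_ae ?_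
    filter_upwards [hb, hw₀, hA] with x hb hw₀ hA
    rw [← ENNReal.ofReal_div_of_pos hw₀, ENNReal.ofReal_rpow_of_pos (by positivity), hA,
      ENNReal.ofReal_mul hc.le]
  have hsum := lintegral_strict_mono_of_ae_le_of_frequently_ae_lt (μ := μ)
    (f := fun x => (ENNReal.ofReal (b x) / ENNReal.ofReal (w₀ x)) ^ a +
      ENNReal.ofReal (a * c) * ENNReal.ofReal (m x * w₀ x))
    (g := fun x => (ENNReal.ofReal (b x) / ENNReal.ofReal (w x)) ^ a +
      ENNReal.ofReal (a * c) * ENNReal.ofReal (m x * w x))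
    (Measurable.aemeasurable (by fun_prop))
    (by
      rw [lintegral_add_right _ (by fun_prop), lintegral_const_mul' _ _ ENNReal.ofReal_ne_top,
        h₀, hfin, mul_one]
      exact ENNReal.add_ne_top.2 ⟨ENNReal.ofReal_ne_top, ENNReal.ofReal_ne_top⟩)
    (hlt.mono fun x hx => by
      rcases eq_or_ne (w x) (w₀ x) with he | hne
      · simp only [he]; rfl
      · exact (hx hne).le)
    ((hne.and_eventually hlt).mono fun x hx => (hx.2 hx.1).ne)
  rw [lintegral_add_right _ (by fun_prop), lintegral_add_right _ (by fun_prop),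
    lintegral_const_mul' _ _ ENNReal.ofReal_ne_top, lintegral_const_mul' _ _ ENNReal.ofReal_ne_top,
    h₀, h] at hsum
  exact lt_of_add_lt_add_right hsum

theorem Ind_eq_two_mul (ℓ : ℝ) (g : ℝ → ℝ) :
    Ind ℓ g = 2 * ∫⁻ x in Ioo (1 / 2 : ℝ) 1,
      (ENNReal.ofReal (x * (1 - x)) / ENNReal.ofReal (rewardCurv g x)) ^ (ℓ / 4) :=
  setLIntegral_Ioo_zero_one_of_symm fun x _ => by
    rw [sub_sub_cancel, mul_comm (1 - x), add_comm (deriv g (1 - x))]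

/-- The second derivative, up to the factor `kappa ℓ`, of the reward function of `gOpt ℓ`. -/
noncomputable def optCurv (ℓ t : ℝ) : ℝ :=
  max t (1 - t) ^ (ℓ / (ℓ + 4)) * (1 - max t (1 - t)) ^ ((ℓ - 8) / (ℓ + 4))

theorem optCurv_symm (ℓ t : ℝ) : optCurv ℓ (1 - t) = optCurv ℓ t := by
  simp [optCurv, max_comm]

theorem max_one_sub_mem_Ioo {t : ℝ} (ht : t ∈ Ioo (0 : ℝ) 1) : max t (1 - t) ∈ Ioo (0 : ℝ) 1 :=
  ⟨lt_max_of_lt_left ht.1, max_lt ht.2 (one_sub_mem_Ioo ht).2⟩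

theorem optCurv_pos (ℓ : ℝ) {t : ℝ} (ht : t ∈ Ioo (0 : ℝ) 1) : 0 < optCurv ℓ t := by
  have h := max_one_sub_mem_Ioo ht
  exact mul_pos (Real.rpow_pos_of_pos h.1 _) (Real.rpow_pos_of_pos (sub_pos.2 h.2) _)

theorem continuousOn_optCurv (ℓ : ℝ) : ContinuousOn (optCurv ℓ) (Ioo 0 1) := by
  have hm : ContinuousOn (fun t : ℝ => max t (1 - t)) (Ioo 0 1) := by fun_prop
  exact (hm.rpow_const fun t ht => .inl (max_one_sub_mem_Ioo ht).1.ne').mul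
    ((continuousOn_const.sub hm).rpow_const
      fun t ht => .inl (sub_pos.2 (max_one_sub_mem_Ioo ht).2).ne')

theorem optCurv_of_half_le {ℓ t : ℝ} (ht : 1 / 2 ≤ t) :
    optCurv ℓ t = t ^ (ℓ / (ℓ + 4)) * (1 - t) ^ ((ℓ - 8) / (ℓ + 4)) := by
  rw [optCurv, max_eq_left (by linarith)]

theorem integrand_of_le_half {ℓ t : ℝ} (hℓ : 0 < ℓ + 4) (h0 : 0 < t) (ht : t ≤ 1 / 2) :
    (t ^ (ℓ - 8) * (1 - t) ^ (2 * ℓ + 4)) ^ (1 / (ℓ + 4)) = (1 - t) * optCurv ℓ t := by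
  rw [← optCurv_symm, optCurv_of_half_le (by linarith), sub_sub_cancel]
  obtain ⟨u, rfl⟩ : ∃ u, t = Real.exp u := ⟨_, (Real.exp_log h0).symm⟩
  obtain ⟨v, hv⟩ : ∃ v, 1 - Real.exp u = Real.exp v := ⟨_, (Real.exp_log (by linarith)).symm⟩
  rw [hv]
  simp only [← Real.exp_mul, ← Real.exp_add]
  congr 1
  field_simp
  ring

theorem integrand_of_half_le {ℓ t : ℝ} (hℓ : 0 < ℓ + 4) (ht : 1 / 2 ≤ t) (h1 : t < 1) :
    (t ^ ℓ * (1 - t) ^ (2 * ℓ - 4)) ^ (1 / (ℓ + 4)) = (1 - t) * optCurv ℓ t := by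
  rw [optCurv_of_half_le ht]
  obtain ⟨u, rfl⟩ : ∃ u, t = Real.exp u := ⟨_, (Real.exp_log (by linarith)).symm⟩
  obtain ⟨v, hv⟩ : ∃ v, 1 - Real.exp u = Real.exp v := ⟨_, (Real.exp_log (by linarith)).symm⟩
  rw [hv]
  simp only [← Real.exp_mul, ← Real.exp_add]
  congr 1
  field_simp
  ring

theorem sq_mul_optCurv {ℓ t : ℝ} (hℓ : 0 < ℓ + 4) (ht : t ∈ Ioo (1 / 2 : ℝ) 1) :
    (1 - t) ^ 2 * optCurv ℓ t = (t * (1 - t) ^ (3 : ℕ)) ^ (ℓ / (ℓ + 4)) := by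
  rw [optCurv_of_half_le ht.1.le]
  obtain ⟨u, rfl⟩ : ∃ u, t = Real.exp u := ⟨_, (Real.exp_log (by linarith [ht.1])).symm⟩
  obtain ⟨v, hv⟩ : ∃ v, 1 - Real.exp u = Real.exp v :=
    ⟨_, (Real.exp_log (by linarith [ht.2])).symm⟩
  rw [hv]
  simp only [← Real.exp_nat_mul, ← Real.exp_mul, ← Real.exp_add]
  congr 1
  push_cast
  field_simp
  ring

theorem div_optCurv_rpow {ℓ k t : ℝ} (hℓ : 0 < ℓ + 4) (hk : 0 < k) (ht : t ∈ Ioo (1 / 2 : ℝ) 1) :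
    (t * (1 - t) / (k * optCurv ℓ t)) ^ (ℓ / 4) =
      k ^ (-(ℓ / 4) - 1) * ((1 - t) ^ 2 * (k * optCurv ℓ t)) := by
  rw [optCurv_of_half_le ht.1.le]
  obtain ⟨u, rfl⟩ : ∃ u, t = Real.exp u := ⟨_, (Real.exp_log (by linarith [ht.1])).symm⟩
  obtain ⟨v, hv⟩ : ∃ v, 1 - Real.exp u = Real.exp v :=
    ⟨_, (Real.exp_log (by linarith [ht.2])).symm⟩
  obtain ⟨r, rfl⟩ : ∃ r, k = Real.exp r := ⟨_, (Real.exp_log hk).symm⟩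
  rw [hv]
  simp only [← Real.exp_nat_mul, ← Real.exp_mul, ← Real.exp_add, ← Real.exp_sub]
  congr 1
  push_cast
  field_simp
  ring

theorem continuous_kappa_integrand {ℓ : ℝ} (hℓ : 0 ≤ ℓ) :
    Continuous fun x : ℝ => (x * (1 - x) ^ (3 : ℕ)) ^ (ℓ / (ℓ + 4)) :=
  Continuous.rpow_const (by fun_prop) fun _ => .inr (by positivity)

theorem kappa_pos {ℓ : ℝ} (hℓ : 0 ≤ ℓ) : 0 < kappa ℓ := by
  refine inv_pos.2 ?_
  rw [integral_Ico_eq_integral_Ioo, ← integral_Ioc_eq_integral_Ioo,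
    ← intervalIntegral.integral_of_le (by norm_num)]
  refine intervalIntegral.intervalIntegral_pos_of_pos_on
    ((continuous_kappa_integrand hℓ).intervalIntegrable _ _) (fun x hx => ?_) (by norm_num)
  have h₁ : 0 < x := by linarith [hx.1]
  have h₂ : 0 < 1 - x := sub_pos.2 hx.2
  positivity

theorem lintegral_sq_mul_optCurv {ℓ : ℝ} (hℓ : 0 ≤ ℓ) :
    ∫⁻ t in Ioo (1 / 2 : ℝ) 1, ENNReal.ofReal ((1 - t) ^ 2 * (kappa ℓ * optCurv ℓ t)) = 1 := by
  have hκ := kappa_pos hℓ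
  have hint : IntegrableOn (fun x : ℝ => (x * (1 - x) ^ (3 : ℕ)) ^ (ℓ / (ℓ + 4)))
      (Ioo (1 / 2) 1) :=
    (continuous_kappa_integrand hℓ).integrableOn_Icc.mono_set Ioo_subset_Icc_self
  have hcongr : ∀ t ∈ Ioo (1 / 2 : ℝ) 1, ENNReal.ofReal ((1 - t) ^ 2 * (kappa ℓ * optCurv ℓ t)) =
      ENNReal.ofReal (kappa ℓ) * ENNReal.ofReal ((t * (1 - t) ^ (3 : ℕ)) ^ (ℓ / (ℓ + 4))) := by
    intro t ht
    rw [← ENNReal.ofReal_mul hκ.le, ← sq_mul_optCurv (by positivity) ht]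
    congr 1
    ring
  rw [setLIntegral_congr_fun measurableSet_Ioo hcongr,
    lintegral_const_mul' _ _ ENNReal.ofReal_ne_top, ← ofReal_integral_eq_lintegral_ofReal hint,
    ← ENNReal.ofReal_mul hκ.le, ← integral_Ico_eq_integral_Ioo, ← inv_inv (∫ _ in _, _)]
  · change ENNReal.ofReal (kappa ℓ * (kappa ℓ)⁻¹) = 1
    rw [mul_inv_cancel₀ hκ.ne', ENNReal.ofReal_one]
  · refine (ae_restrict_iff' measurableSet_Ioo).2 (.of_forall fun x hx => ?_)
    have h₁ : 0 < x := by linarith [hx.1]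
    have h₂ : 0 < 1 - x := sub_pos.2 hx.2
    simp only [Pi.zero_apply]
    positivity

theorem gOpt_half (ℓ : ℝ) : gOpt ℓ (1 / 2) = 0 := by
  simp [gOpt]

theorem gOpt_eq_integral {ℓ x : ℝ} (hℓ : 0 < ℓ + 4) (hx : x ∈ Ioo (0 : ℝ) 1) :
    gOpt ℓ x = kappa ℓ * ∫ t in (1 / 2 : ℝ)..x, (1 - t) * optCurv ℓ t := by
  unfold gOpt
  split_ifs with h
  · congr 1
    refine intervalIntegral.integral_congr fun t ht => ?_
    rw [uIcc_of_ge h] at ht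
    exact integrand_of_le_half hℓ (hx.1.trans_le ht.1) ht.2
  · congr 1
    refine intervalIntegral.integral_congr fun t ht => ?_
    rw [uIcc_of_le (not_le.1 h).le] at ht
    exact integrand_of_half_le hℓ ht.1 (ht.2.trans_lt hx.2)

theorem hasDerivAt_gOpt {ℓ x : ℝ} (hℓ : 0 < ℓ + 4) (hx : x ∈ Ioo (0 : ℝ) 1) :
    HasDerivAt (gOpt ℓ) (kappa ℓ * ((1 - x) * optCurv ℓ x)) x := by
  have hc : ContinuousOn (fun t => (1 - t) * optCurv ℓ t) (Ioo 0 1) :=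
    (continuousOn_const.sub continuousOn_id).mul (continuousOn_optCurv ℓ)
  have hsub : uIcc (1 / 2) x ⊆ Ioo (0 : ℝ) 1 :=
    ordConnected_Ioo.uIcc_subset ⟨by norm_num, by norm_num⟩ hx
  refine ((intervalIntegral.integral_hasDerivAt_right (hc.mono hsub).intervalIntegrable
    (hc.stronglyMeasurableAtFilter isOpen_Ioo x hx)
    (hc.continuousAt (isOpen_Ioo.mem_nhds hx))).const_mul (kappa ℓ)).congr_of_eventuallyEq ?_
  filter_upwards [isOpen_Ioo.mem_nhds hx] with y hy using gOpt_eq_integral hℓ hy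

theorem rewardCurv_gOpt {ℓ x : ℝ} (hℓ : 0 < ℓ + 4) (hx : x ∈ Ioo (0 : ℝ) 1) :
    rewardCurv (gOpt ℓ) x = kappa ℓ * optCurv ℓ x := by
  rw [rewardCurv, (hasDerivAt_gOpt hℓ hx).deriv, (hasDerivAt_gOpt hℓ (one_sub_mem_Ioo hx)).deriv,
    optCurv_symm]
  ring

theorem contDiffOn_gOpt {ℓ : ℝ} (hℓ : 0 < ℓ + 4) : ContDiffOn ℝ 1 (gOpt ℓ) (Ioo 0 1) := by
  rw [contDiffOn_one_iff_derivWithin isOpen_Ioo.uniqueDiffOn]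
  refine ⟨fun x hx => (hasDerivAt_gOpt hℓ hx).differentiableAt.differentiableWithinAt, ?_⟩
  have hc : ContinuousOn (fun t => kappa ℓ * ((1 - t) * optCurv ℓ t)) (Ioo 0 1) :=
    continuousOn_const.mul ((continuousOn_const.sub continuousOn_id).mul (continuousOn_optCurv ℓ))
  refine hc.congr fun x hx => ?_
  rw [derivWithin_of_isOpen isOpen_Ioo hx, (hasDerivAt_gOpt hℓ hx).deriv]

theorem isProperRule_gOpt {ℓ : ℝ} (hℓ : 0 ≤ ℓ) : IsProperRule (gOpt ℓ) := by
  have hℓ' : 0 < ℓ + 4 := by positivity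
  refine isProperRule_of_rewardCurv_pos (contDiffOn_gOpt hℓ') (fun t ht => ?_) fun t ht => ?_
  · rw [rewardCurv_gOpt hℓ' ht, (hasDerivAt_gOpt hℓ' ht).deriv]
    ring
  · rw [rewardCurv_gOpt hℓ' ht]
    exact mul_pos (kappa_pos hℓ) (optCurv_pos ℓ ht)

theorem lintegral_sq_mul_rewardCurv_gOpt {ℓ : ℝ} (hℓ : 0 ≤ ℓ) :
    ∫⁻ t in Ioo (1 / 2 : ℝ) 1, ENNReal.ofReal ((1 - t) ^ 2 * rewardCurv (gOpt ℓ) t) = 1 := by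
  rw [← lintegral_sq_mul_optCurv hℓ]
  refine setLIntegral_congr_fun measurableSet_Ioo fun t ht => ?_
  rw [rewardCurv_gOpt (by positivity) (Ioo_subset_Ioo_left (by norm_num) ht)]

theorem isNormalizedRule_gOpt {ℓ : ℝ} (hℓ : 0 ≤ ℓ) : IsNormalizedRule (gOpt ℓ) :=
  ⟨gOpt_half ℓ, (integral_rewardFn_eq_one_iff (contDiffOn_gOpt (by positivity)) (gOpt_half ℓ)
    (isProperRule_gOpt hℓ)).2 (lintegral_sq_mul_rewardCurv_gOpt hℓ)⟩

theorem eqOn_of_rewardCurv_eqOn {f g : ℝ → ℝ} (hf : ContDiffOn ℝ 1 f (Ioo 0 1))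
    (hg : ContDiffOn ℝ 1 g (Ioo 0 1)) (hfp : IsProperRule f) (hgp : IsProperRule g)
    (h0 : f (1 / 2) = g (1 / 2))
    (h : EqOn (rewardCurv f) (rewardCurv g) (Ioo (1 / 2) 1)) : EqOn f g (Ioo 0 1) := by
  have hIco : EqOn (rewardCurv f) (rewardCurv g) (Ico (1 / 2) 1) := by
    have hsub : Ico (1 / 2 : ℝ) 1 ⊆ Ioo 0 1 := fun t ht => ⟨by linarith [ht.1], ht.2⟩
    refine h.of_subset_closure ((continuousOn_rewardCurv hf).mono hsub)
      ((continuousOn_rewardCurv hg).mono hsub) Ioo_subset_Ico_self ?_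
    rw [closure_Ioo (by norm_num)]
    exact Ico_subset_Icc_self
  have hall : EqOn (rewardCurv f) (rewardCurv g) (Ioo 0 1) := by
    intro t ht
    rcases le_total (1 / 2) t with h | h
    · exact hIco ⟨h, ht.2⟩
    · rw [← rewardCurv_symm f, ← rewardCurv_symm g]
      exact hIco ⟨by linarith, by linarith [ht.1]⟩
  refine isOpen_Ioo.eqOn_of_deriv_eq isPreconnected_Ioo (hf.differentiableOn one_ne_zero)
    (hg.differentiableOn one_ne_zero) (fun t ht => ?_) (x := 1 / 2) ⟨by norm_num, by norm_num⟩ h0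
  rw [hfp.deriv_eq hf ht, hgp.deriv_eq hg ht, hall ht]

theorem frequently_ae_ne_of_not_eqOn {f g : ℝ → ℝ} {s : Set ℝ} (hs : IsOpen s)
    (hf : ContinuousOn f s) (hg : ContinuousOn g s) (h : ¬ EqOn f g s) :
    ∃ᵐ x ∂volume.restrict s, f x ≠ g x := fun hae =>
  h (Measure.eqOn_open_of_ae_eq (hae.mono fun _ hx => not_not.1 hx) hs hf hg)

theorem gOpt_is_unique_optimal (ℓ : ℝ) (hℓ : 1 ≤ ℓ) :
    ContDiffOn ℝ 1 (gOpt ℓ) (Set.Ioo 0 1) ∧ IsProperRule (gOpt ℓ) ∧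
      IsNormalizedRule (gOpt ℓ) ∧
    ∀ g : ℝ → ℝ, ContDiffOn ℝ 1 g (Set.Ioo 0 1) → IsProperRule g → IsNormalizedRule g →
      (¬ ∀ x ∈ Set.Ioo (0:ℝ) 1, g x = gOpt ℓ x) → Ind ℓ (gOpt ℓ) < Ind ℓ g := by
  have hℓ₀ : 0 ≤ ℓ := zero_le_one.trans hℓ
  have hℓ' : 0 < ℓ + 4 := by positivity
  have hO := contDiffOn_gOpt hℓ'
  have hOp := isProperRule_gOpt hℓ₀
  refine ⟨hO, hOp, isNormalizedRule_gOpt hℓ₀, fun g hg hp hn hne => ?_⟩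
  have hsub : Ioo (1 / 2 : ℝ) 1 ⊆ Ioo 0 1 := Ioo_subset_Ioo_left (by norm_num)
  have hae {P : ℝ → Prop} (hP : ∀ x ∈ Ioo (1 / 2 : ℝ) 1, P x) :
      ∀ᵐ x ∂volume.restrict (Ioo (1 / 2 : ℝ) 1), P x :=
    (ae_restrict_iff' measurableSet_Ioo).2 (.of_forall hP)
  rw [Ind_eq_two_mul, Ind_eq_two_mul]
  refine ENNReal.mul_lt_mul_right (by norm_num) (by norm_num) ?_
  refine lintegral_rpow_lt_of_weighted_lintegral_eq_one (c := kappa ℓ ^ (-(ℓ / 4) - 1))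
    (m := fun x => (1 - x) ^ 2) (by positivity) (Real.rpow_pos_of_pos (kappa_pos hℓ₀) _)
    (by fun_prop) (by fun_prop) (measurable_rewardCurv g) (measurable_rewardCurv _)
    (hae fun x hx => mul_pos (hsub hx).1 (sub_pos.2 hx.2))
    (hae fun x hx => hp.rewardCurv_nonneg hg (hsub hx)) (hae fun x hx => ?_) (hae fun x hx => ?_)
    (lintegral_sq_mul_rewardCurv_gOpt hℓ₀) ((integral_rewardFn_eq_one_iff hg hn.1 hp).1 hn.2)
    (frequently_ae_ne_of_not_eqOn isOpen_Ioo ((continuousOn_rewardCurv hg).mono hsub)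
      ((continuousOn_rewardCurv hO).mono hsub) fun h =>
        hne (eqOn_of_rewardCurv_eqOn hg hO hp hOp (hn.1.trans (gOpt_half ℓ).symm) h))
  · rw [rewardCurv_gOpt hℓ' (hsub hx)]
    exact mul_pos (kappa_pos hℓ₀) (optCurv_pos ℓ (hsub hx))
  · rw [rewardCurv_gOpt hℓ' (hsub hx)]
    exact div_optCurv_rpow hℓ' (kappa_pos hℓ₀) hx
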